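/- arXiv:2302.05182 — 3 statements merged into one kernel-verified Lean document; each statement's English description precedes it below -/
import Mathlib

section
/- Let (μ_{t,x}) be a family of Borel probability measures on ℝ^d indexed by t ∈ ℝ and x ∈ ℝ^s, and let μ be a Borel probability measure on ℝ^d, such that μ_{t,x} converges weakly to μ as t → ∞ uniformly on compact sets of x. Let ψ : ℝ^s → ℝ^d and φ : ℝ^s → ℝ^d be continuous functions with every component of φ(x) strictly positive for all x ∈ ℝ^s. Then for every bounded continuous f : ℝ^d → ℝ, ∫_{ℝ^d} f(ψ(x) + φ(x)·y) μ_{t,x}(dy) → ∫_{ℝ^d} f(ψ(x) + φ(x)·y) μ(dy) as t → ∞, and the convergence is uniform over x in compact subsets of ℝ^s (here φ(x)·y denotes componentwise multiplication). -/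
open Filter MeasureTheory

open scoped Topology BoundedContinuousFunction

/-- A probability measure which is inner regular for compact sets almost charges a compactly
supported continuous cutoff. -/
theorem exists_hasCompactSupport_lt_integral {Y : Type*} [TopologicalSpace Y] [RegularSpace Y]
    [LocallyCompactSpace Y] [MeasurableSpace Y] [BorelSpace Y] (ν : Measure Y)
    [IsProbabilityMeasure ν] [ν.Regular] {δ : ℝ} (hδ : 0 < δ) :
    ∃ χ : Y →ᵇ ℝ, HasCompactSupport χ ∧ (∀ y, 0 ≤ χ y) ∧ (∀ y, χ y ≤ 1) ∧
      1 - δ < ∫ y, χ y ∂ν := by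
  obtain ⟨C, -, hC, hνC⟩ : ∃ C, C ⊆ Set.univ ∧ IsCompact C ∧ ENNReal.ofReal (1 - δ) < ν C := by
    refine isOpen_univ.exists_lt_isCompact ?_
    rw [measure_univ, ENNReal.ofReal_lt_one]
    linarith
  obtain ⟨g, hg1, -, hgc, hg⟩ :=
    exists_continuous_one_zero_of_isCompact hC isClosed_empty (Set.disjoint_empty C)
  let χ : Y →ᵇ ℝ := BoundedContinuousFunction.ofNormedAddCommGroup g g.continuous 1
    fun y => by rw [Real.norm_of_nonneg (hg y).1]; exact (hg y).2
  refine ⟨χ, hgc, fun y => (hg y).1, fun y => (hg y).2, ?_⟩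
  calc 1 - δ < ν.real {y | 1 ≤ χ y} := by
        rw [← ofReal_measureReal, ENNReal.ofReal_lt_ofReal_iff'] at hνC
        refine hνC.1.trans_le ?_
        exact measureReal_mono fun y hy => (hg1 hy).ge
    _ ≤ ∫ y, χ y ∂ν := by
        have hle := mul_meas_ge_le_integral_of_nonneg (ae_of_all ν fun y => (hg y).1)
          (χ.integrable ν) 1
        rwa [one_mul] at hle

/-- Replacing a bounded function `g` by `χ * h`, where `χ` is a cutoff and `h` is close to `g`
on the support of `χ`, changes its integral by little. -/
theorem abs_integral_sub_integral_mul_le {Y : Type*} [TopologicalSpace Y] [MeasurableSpace Y]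
    [OpensMeasurableSpace Y] (m : Measure Y) [IsProbabilityMeasure m] (g h χ : Y →ᵇ ℝ) {δ M : ℝ}
    (hδ : 0 ≤ δ) (hg : ‖g‖ ≤ M) (hχ0 : ∀ y, 0 ≤ χ y) (hχ1 : ∀ y, χ y ≤ 1)
    (hgh : ∀ y ∈ tsupport χ, |g y - h y| ≤ δ) :
    |(∫ y, g y ∂m) - ∫ y, (χ * h) y ∂m| ≤ δ + M * (1 - ∫ y, χ y ∂m) := by
  have hχint : Integrable (fun y => M * (1 - χ y)) m :=
    ((integrable_const 1).sub (χ.integrable m)).const_mul M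
  have hint : ∫ y, (δ + M * (1 - χ y)) ∂m = δ + M * (1 - ∫ y, χ y ∂m) := by
    rw [integral_add (integrable_const _) hχint, integral_const_mul,
      integral_sub (integrable_const _) (χ.integrable m)]
    simp
  rw [← integral_sub (g.integrable m) ((χ * h).integrable m), ← hint]
  refine (abs_integral_le_integral_abs).trans (integral_mono
    ((g.integrable m).sub ((χ * h).integrable m)).abs
    ((integrable_const _).add hχint) fun y => ?_)
  have hgy : |g y| ≤ M := (g.norm_coe_le_norm y).trans hg
  have hclose : χ y * |g y - h y| ≤ δ := by
    by_cases hy : y ∈ tsupport χ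
    · exact (mul_le_of_le_one_left (abs_nonneg _) (hχ1 y)).trans (hgh y hy)
    · simpa [image_eq_zero_of_notMem_tsupport hy] using hδ
  calc |g y - (χ * h) y| = |χ y * (g y - h y) + (1 - χ y) * g y| := by
        rw [BoundedContinuousFunction.mul_apply]; ring_nf
    _ ≤ |χ y * (g y - h y)| + |(1 - χ y) * g y| := abs_add_le _ _
    _ = χ y * |g y - h y| + |g y| * (1 - χ y) := by
        rw [abs_mul, abs_mul, abs_of_nonneg (hχ0 y), abs_of_nonneg (sub_nonneg.2 (hχ1 y)),
          mul_comm (1 - χ y)]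
    _ ≤ δ + M * (1 - χ y) :=
        add_le_add hclose (mul_le_mul_of_nonneg_right hgy (sub_nonneg.2 (hχ1 y)))

/-- Weak convergence which is uniform on compact sets of parameters allows the integrand to
depend on the parameter, as long as it is jointly continuous and uniformly bounded. -/
theorem integral_tendsto_of_unif_weak_conv_of_continuous_uncurry {X Y : Type*}
    [TopologicalSpace X] [TopologicalSpace Y] [RegularSpace Y] [LocallyCompactSpace Y]
    [MeasurableSpace Y] [BorelSpace Y] (μ : ℝ → X → Measure Y) (ν : Measure Y)
    (hprob : ∀ t x, IsProbabilityMeasure (μ t x)) [IsProbabilityMeasure ν] [ν.Regular]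
    (hweak : ∀ f : Y →ᵇ ℝ, ∀ K : Set X, IsCompact K → ∀ ε > (0 : ℝ), ∃ T : ℝ, ∀ t > T, ∀ x ∈ K,
      |(∫ y, f y ∂(μ t x)) - ∫ y, f y ∂ν| < ε)
    (F : X → Y →ᵇ ℝ) (hF : Continuous fun p : X × Y => F p.1 p.2) {M : ℝ}
    (hM : ∀ x, ‖F x‖ ≤ M) {K : Set X} (hK : IsCompact K) {ε : ℝ} (hε : 0 < ε) :
    ∃ T : ℝ, ∀ t > T, ∀ x ∈ K, |(∫ y, F x y ∂(μ t x)) - ∫ y, F x y ∂ν| < ε := by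
  refine hK.induction_on (p := fun S => ∃ T : ℝ, ∀ t > T, ∀ x ∈ S,
      |(∫ y, F x y ∂(μ t x)) - ∫ y, F x y ∂ν| < ε) ⟨0, by simp⟩
    (fun S S' hS ⟨T, hT⟩ => ⟨T, fun t ht x hx => hT t ht x (hS hx)⟩) ?_ fun x₀ hx₀ => ?_
  · rintro S S' ⟨T, hT⟩ ⟨T', hT'⟩
    exact ⟨max T T', fun t ht x hx => hx.elim
      (hT t ((le_max_left _ _).trans_lt ht) x) (hT' t ((le_max_right _ _).trans_lt ht) x)⟩
  have hM0 : 0 ≤ M := (norm_nonneg _).trans (hM x₀)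
  obtain ⟨δ, hδ, hδε⟩ : ∃ δ > 0, 3 * (δ + M * δ) = ε :=
    ⟨ε / (3 * (1 + M)), by positivity, by field_simp⟩
  obtain ⟨χ, hχc, hχ0, hχ1, hχν⟩ := exists_hasCompactSupport_lt_integral ν hδ
  have hnear : ∀ᶠ x in 𝓝 x₀, ∀ y ∈ tsupport χ, |F x y - F x₀ y| < δ := by
    refine hχc.isCompact.eventually_forall_of_forall_eventually fun y _ => ?_
    have hcont : Continuous fun p : X × Y => |F p.1 p.2 - F x₀ p.2| :=
      (hF.sub ((F x₀).continuous.comp continuous_snd)).abs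
    exact hcont.continuousAt.eventually_lt_const (by simpa using hδ)
  obtain ⟨T₁, hT₁⟩ := hweak χ K hK δ hδ
  obtain ⟨T₂, hT₂⟩ := hweak (χ * F x₀) K hK δ hδ
  refine ⟨K ∩ {x | ∀ y ∈ tsupport χ, |F x y - F x₀ y| < δ},
    inter_mem_nhdsWithin K hnear, max T₁ T₂, fun t ht x hx => ?_⟩
  have := hprob t x
  have h₁ := abs_lt.1 (hT₁ t ((le_max_left _ _).trans_lt ht) x hx.1)
  have h₂ := abs_lt.1 (hT₂ t ((le_max_right _ _).trans_lt ht) x hx.1)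
  have hclose : ∀ y ∈ tsupport χ, |F x y - F x₀ y| ≤ δ := fun y hy => (hx.2 y hy).le
  have hμ := abs_le.1 (abs_integral_sub_integral_mul_le (μ t x) (F x) (F x₀) χ hδ.le (hM x)
    hχ0 hχ1 hclose)
  have hν := abs_le.1 (abs_integral_sub_integral_mul_le ν (F x) (F x₀) χ hδ.le (hM x)
    hχ0 hχ1 hclose)
  have hMμ : M * (1 - ∫ y, χ y ∂(μ t x)) ≤ M * (2 * δ) :=
    mul_le_mul_of_nonneg_left (by linarith) hM0
  have hMν : M * (1 - ∫ y, χ y ∂ν) ≤ M * δ := mul_le_mul_of_nonneg_left (by linarith) hM0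
  rw [abs_lt]
  constructor <;> linarith

/-- **Lemma A.4: continuous location–scale changes inside uniformly weakly convergent
integrals.**  If `μ t x → ν` weakly as `t → ∞` uniformly over `x` in compact sets,
`ψ, φ : ℝ^s → ℝ^d` are continuous with `φ` componentwise strictly positive, then for
every bounded continuous `f : ℝ^d → ℝ`,
`∫ f(ψ(x) + φ(x)·y) μ_{t,x}(dy) → ∫ f(ψ(x) + φ(x)·y) ν(dy)` uniformly over `x` in
compact subsets of `ℝ^s` (componentwise product). -/
theorem integral_loc_scale_tendsto_of_unif_weak_conv
    (d s : ℕ) (μ : ℝ → (Fin s → ℝ) → Measure (Fin d → ℝ))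
    (ν : Measure (Fin d → ℝ))
    (hprob : ∀ t x, IsProbabilityMeasure (μ t x)) [IsProbabilityMeasure ν]
    (hweak : ∀ f : BoundedContinuousFunction (Fin d → ℝ) ℝ,
      ∀ K : Set (Fin s → ℝ), IsCompact K → ∀ ε > (0 : ℝ), ∃ T : ℝ, ∀ t > T, ∀ x ∈ K,
        |(∫ y, f y ∂(μ t x)) - ∫ y, f y ∂ν| < ε)
    (ψ φ : (Fin s → ℝ) → Fin d → ℝ)
    (hψ : Continuous ψ) (hφ : Continuous φ)
    (hφpos : ∀ x j, 0 < φ x j) :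
    ∀ f : BoundedContinuousFunction (Fin d → ℝ) ℝ,
      ∀ K : Set (Fin s → ℝ), IsCompact K → ∀ ε > (0 : ℝ), ∃ T : ℝ, ∀ t > T, ∀ x ∈ K,
        |(∫ y, f (fun j => ψ x j + φ x j * y j) ∂(μ t x)) -
          ∫ y, f (fun j => ψ x j + φ x j * y j) ∂ν| < ε := by
  intro f K hK ε hε
  let F : (Fin s → ℝ) → (Fin d → ℝ) →ᵇ ℝ := fun x =>
    f.compContinuous ⟨fun y j => ψ x j + φ x j * y j, by fun_prop⟩
  have hF : Continuous fun p : (Fin s → ℝ) × (Fin d → ℝ) => F p.1 p.2 :=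
    f.continuous.comp (by fun_prop :
      Continuous fun p : (Fin s → ℝ) × (Fin d → ℝ) => fun j => ψ p.1 j + φ p.1 j * p.2 j)
  exact integral_tendsto_of_unif_weak_conv_of_continuous_uncurry μ ν hprob hweak F hF
    (fun x => f.norm_compContinuous_le _) hK hε
end

section
/- Let κ be a Markov kernel from ℝ^s to the Borel probability measures on ℝ^m. Let a^{(v)}_S : ℝ → ℝ^s, b^{(v)}_S : ℝ → (0,∞)^s, a^{(v)}_{C∖S} : ℝ → ℝ^m, b^{(v)}_{C∖S} : ℝ → (0,∞)^m, a^{(S)} : ℝ^s → ℝ^m and b^{(S)} : ℝ^s → (0,∞)^m be measurable, let ψ : ℝ^s → ℝ^m and φ : ℝ^s → (0,∞)^m be continuous, and let G be a Borel probability measure on ℝ^m. Write T(x,t) := a^{(v)}_S(t) + b^{(v)}_S(t)·x. Assume: (i) the remainder terms A(x,t) := [a^{(v)}_{C∖S}(t) − a^{(S)}(T(x,t)) + b^{(v)}_{C∖S}(t)·ψ(x)] / b^{(S)}(T(x,t)) and B(x,t) := 1 − b^{(v)}_{C∖S}(t)·φ(x)/b^{(S)}(T(x,t)) converge to 0 componentwise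 as t → ∞, uniformly over x in compact subsets of ℝ^s; (ii) the family of pushforwards of κ(T(x,t)) under y ↦ (y − a^{(S)}(T(x,t)))/b^{(S)}(T(x,t)) converges weakly, as t → ∞, to G uniformly on compact sets of x. Then for every bounded continuous f : ℝ^m → ℝ, ∫_{ℝ^m} f((y − a^{(v)}_{C∖S}(t))/b^{(v)}_{C∖S}(t)) κ(T(x,t))(dy) → ∫_{ℝ^m} f(ψ(x) + φ(x)·y) G(dy) as t → ∞, and the convergence is uniform over x in compact subsets of ℝ^s. -/
open Filter MeasureTheory ProbabilityTheory

open scoped Topology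

/-- If `μs i` converges weakly to `μ` and the parameters `p i` converge to `p₀`, then integrals of
a bounded continuous function of a jointly continuous map converge. -/
lemma tendsto_integral_comp_of_tendsto_param {ι X P Y : Type*} {l : Filter ι}
    [TopologicalSpace X] [SecondCountableTopology X] [TopologicalSpace.PseudoMetrizableSpace X]
    [MeasurableSpace X] [OpensMeasurableSpace X]
    [TopologicalSpace P] [SecondCountableTopology P] [TopologicalSpace.PseudoMetrizableSpace P]
    [MeasurableSpace P] [OpensMeasurableSpace P] [TopologicalSpace Y]
    {μs : ι → ProbabilityMeasure X} {μ : ProbabilityMeasure X} (hμ : Tendsto μs l (𝓝 μ))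
    {p : ι → P} {p₀ : P} (hp : Tendsto p l (𝓝 p₀))
    {H : X × P → Y} (hH : Continuous H) (f : BoundedContinuousFunction Y ℝ) :
    Tendsto (fun i => ∫ z, f (H (z, p i)) ∂(μs i : Measure X)) l
      (𝓝 (∫ z, f (H (z, p₀)) ∂(μ : Measure X))) := by
  have hprod : Tendsto (fun i => (μs i).prod (diracProba (p i))) l
      (𝓝 (μ.prod (diracProba p₀))) :=
    (ProbabilityMeasure.continuous_prod.tendsto (μ, diracProba p₀)).comp
      (hμ.prodMk_nhds ((continuous_diracProba.tendsto p₀).comp hp))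
  have hint := ProbabilityMeasure.tendsto_iff_forall_integral_tendsto.1 hprod
    (f.compContinuous ⟨H, hH⟩)
  have key : ∀ (ν : ProbabilityMeasure X) (c : P),
      ∫ w, f.compContinuous ⟨H, hH⟩ w ∂((ν.prod (diracProba c) : ProbabilityMeasure (X × P)) :
        Measure (X × P)) = ∫ z, f (H (z, c)) ∂(ν : Measure X) := by
    intro ν c
    have hd : ((diracProba c : ProbabilityMeasure P) : Measure P) = Measure.dirac c := rfl
    rw [ProbabilityMeasure.toMeasure_prod, hd, Measure.prod_dirac,
      integral_map (by fun_prop)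
        (f.compContinuous ⟨H, hH⟩).continuous.stronglyMeasurable.aestronglyMeasurable]
    rfl
  simpa only [key] using hint

/-- A bound that holds eventually, uniformly on `K`, for every `ε` gives convergence to `0` along
`atTop ×ˢ 𝓟 K`. -/
lemma tendsto_zero_atTop_prod_principal_iff {X : Type*} {K : Set X} {F : ℝ × X → ℝ} :
    Tendsto F (atTop ×ˢ 𝓟 K) (𝓝 0) ↔
      ∀ ε > (0 : ℝ), ∃ T₀ : ℝ, ∀ t > T₀, ∀ x ∈ K, |F (t, x)| < ε := by
  simp only [Metric.tendsto_nhds, Real.dist_eq, sub_zero, eventually_prod_principal_iff]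
  refine forall₂_congr fun ε _ => ?_
  exact (atTop_basis_Ioi (α := ℝ)).eventually_iff.trans (by simp)

/-- **Lemma A.5: renormalizing a transition kernel by conditioning-variable normings.**
Let `κ` be a Markov kernel from `ℝ^s` to `ℝ^m`, and let the norming and update
functions satisfy the remainder conditions (i) and the uniform weak convergence (ii)
of Assumption A₂.  Then for every bounded continuous `f : ℝ^m → ℝ`,
`∫ f((y − a^{(v)}_{C∖S}(t))/b^{(v)}_{C∖S}(t)) κ(T(x,t))(dy) → ∫ f(ψ(x) + φ(x)·y) G(dy)`
as `t → ∞`, uniformly over `x` in compact subsets of `ℝ^s`. -/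
theorem kernel_renormalization_unif_weak_conv
    (s m : ℕ)
    (κ : Kernel (Fin s → ℝ) (Fin m → ℝ)) [IsMarkovKernel κ]
    (aVS bVS : ℝ → Fin s → ℝ) (aVC bVC : ℝ → Fin m → ℝ)
    (aS bS : (Fin s → ℝ) → Fin m → ℝ)
    (haVS : Measurable aVS) (hbVS : Measurable bVS)
    (haVC : Measurable aVC) (hbVC : Measurable bVC)
    (haS : Measurable aS) (hbS : Measurable bS)
    (hbVSpos : ∀ t j, 0 < bVS t j) (hbVCpos : ∀ t j, 0 < bVC t j)
    (hbSpos : ∀ x j, 0 < bS x j)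
    (ψ φ : (Fin s → ℝ) → Fin m → ℝ) (hψ : Continuous ψ) (hφ : Continuous φ)
    (hφpos : ∀ x j, 0 < φ x j)
    (G : Measure (Fin m → ℝ)) [IsProbabilityMeasure G]
    (T : (Fin s → ℝ) → ℝ → Fin s → ℝ)
    (hT : ∀ x t, T x t = fun j => aVS t j + bVS t j * x j)
    -- (i) the remainder terms vanish uniformly on compact sets
    (hA : ∀ K : Set (Fin s → ℝ), IsCompact K → ∀ ε > (0 : ℝ), ∃ T₀ : ℝ,
      ∀ t > T₀, ∀ x ∈ K, ∀ j : Fin m,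
        |(aVC t j - aS (T x t) j + bVC t j * ψ x j) / bS (T x t) j| < ε)
    (hB : ∀ K : Set (Fin s → ℝ), IsCompact K → ∀ ε > (0 : ℝ), ∃ T₀ : ℝ,
      ∀ t > T₀, ∀ x ∈ K, ∀ j : Fin m,
        |1 - bVC t j * φ x j / bS (T x t) j| < ε)
    -- (ii) separator-normalized kernels converge weakly, uniformly on compact sets
    (hweak : ∀ f : BoundedContinuousFunction (Fin m → ℝ) ℝ,
      ∀ K : Set (Fin s → ℝ), IsCompact K → ∀ ε > (0 : ℝ), ∃ T₀ : ℝ,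
        ∀ t > T₀, ∀ x ∈ K,
          |(∫ y, f y ∂((κ (T x t)).map
              (fun y (j : Fin m) => (y j - aS (T x t) j) / bS (T x t) j))) -
            ∫ y, f y ∂G| < ε) :
    ∀ f : BoundedContinuousFunction (Fin m → ℝ) ℝ,
      ∀ K : Set (Fin s → ℝ), IsCompact K → ∀ ε > (0 : ℝ), ∃ T₀ : ℝ,
        ∀ t > T₀, ∀ x ∈ K,
          |(∫ y, f (fun j => (y j - aVC t j) / bVC t j) ∂(κ (T x t))) -
            ∫ y, f (fun j => ψ x j + φ x j * y j) ∂G| < ε := by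
  intro f K hK
  suffices h : Tendsto (fun z : ℝ × (Fin s → ℝ) =>
      (∫ y, f (fun j => (y j - aVC z.1 j) / bVC z.1 j) ∂(κ (T z.2 z.1))) -
        ∫ y, f (fun j => ψ z.2 j + φ z.2 j * y j) ∂G) (atTop ×ˢ 𝓟 K) (𝓝 0) from
    tendsto_zero_atTop_prod_principal_iff.1 h
  rw [tendsto_iff_ultrafilter]
  intro U hU
  have hUK : Tendsto Prod.snd (U : Filter (ℝ × (Fin s → ℝ))) (𝓟 K) := tendsto_snd.mono_left hU
  obtain ⟨x₀, -, hx₀⟩ := hK.ultrafilter_le_nhds (U.map Prod.snd) hUK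
  replace hx₀ : Tendsto Prod.snd (U : Filter (ℝ × (Fin s → ℝ))) (𝓝 x₀) := hx₀
  have hψU := (hψ.tendsto x₀).comp hx₀
  have hφU := (hφ.tendsto x₀).comp hx₀
  let N : ℝ × (Fin s → ℝ) → (Fin m → ℝ) → Fin m → ℝ :=
    fun z y j => (y j - aS (T z.2 z.1) j) / bS (T z.2 z.1) j
  have hN : ∀ z, Measurable (N z) := fun z => by fun_prop
  let μs : ℝ × (Fin s → ℝ) → ProbabilityMeasure (Fin m → ℝ) := fun z =>
    ⟨(κ (T z.2 z.1)).map (N z), Measure.isProbabilityMeasure_map (hN z).aemeasurable⟩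
  let μG : ProbabilityMeasure (Fin m → ℝ) := ⟨G, inferInstance⟩
  have hμs : Tendsto μs U (𝓝 μG) := by
    rw [ProbabilityMeasure.tendsto_iff_forall_integral_tendsto]
    intro g
    rw [← tendsto_sub_nhds_zero_iff]
    exact (tendsto_zero_atTop_prod_principal_iff.2 (hweak g K hK)).mono_left hU
  let q : ℝ × (Fin s → ℝ) → Fin m → ℝ := fun z j => bS (T z.2 z.1) j / bVC z.1 j
  let p : ℝ × (Fin s → ℝ) → Fin m → ℝ := fun z j => (aS (T z.2 z.1) j - aVC z.1 j) / bVC z.1 j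
  have hq : Tendsto q U (𝓝 (φ x₀)) := by
    rw [tendsto_pi_nhds]
    intro j
    have hBj : Tendsto (fun z : ℝ × (Fin s → ℝ) =>
        1 - bVC z.1 j * φ z.2 j / bS (T z.2 z.1) j) U (𝓝 0) :=
      (tendsto_zero_atTop_prod_principal_iff.2 fun ε hε =>
        (hB K hK ε hε).imp fun T₀ h t ht x hx => h t ht x hx j).mono_left hU
    have hlim := (tendsto_pi_nhds.1 hφU j).div (hBj.const_sub 1) (by norm_num)
    simp only [sub_zero, div_one] at hlim
    refine hlim.congr fun z => ?_
    have h1 := (hbVCpos z.1 j).ne'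
    have h2 := (hbSpos (T z.2 z.1) j).ne'
    have h3 := (hφpos z.2 j).ne'
    simp only [q, Pi.div_apply, Function.comp_apply, sub_sub_cancel]
    field_simp
  have hp : Tendsto p U (𝓝 (ψ x₀)) := by
    rw [tendsto_pi_nhds]
    intro j
    have hAj : Tendsto (fun z : ℝ × (Fin s → ℝ) =>
        (aVC z.1 j - aS (T z.2 z.1) j + bVC z.1 j * ψ z.2 j) / bS (T z.2 z.1) j) U (𝓝 0) :=
      (tendsto_zero_atTop_prod_principal_iff.2 fun ε hε =>
        (hA K hK ε hε).imp fun T₀ h t ht x hx => h t ht x hx j).mono_left hU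
    have hlim := (tendsto_pi_nhds.1 hψU j).sub (hAj.mul (tendsto_pi_nhds.1 hq j))
    simp only [zero_mul, sub_zero] at hlim
    refine hlim.congr fun z => ?_
    have h1 := (hbVCpos z.1 j).ne'
    have h2 := (hbSpos (T z.2 z.1) j).ne'
    simp only [q, p, Function.comp_apply]
    field_simp
    ring
  let H : (Fin m → ℝ) × ((Fin m → ℝ) × (Fin m → ℝ)) → Fin m → ℝ :=
    fun w j => w.2.1 j + w.2.2 j * w.1 j
  have hH : Continuous H := by fun_prop
  have hlim₁ := tendsto_integral_comp_of_tendsto_param hμs (hp.prodMk_nhds hq) hH f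
  have hlim₂ := tendsto_integral_comp_of_tendsto_param (tendsto_const_nhds (x := μG))
    (hψU.prodMk_nhds hφU) hH f
  have hlim := hlim₁.sub hlim₂
  rw [sub_self] at hlim
  refine hlim.congr fun z => ?_
  congr 1
  have hmeas : AEStronglyMeasurable (fun y => f (H (y, (p z, q z))))
      ((κ (T z.2 z.1)).map (N z)) :=
    (f.continuous.comp (hH.comp (by fun_prop))).stronglyMeasurable.aestronglyMeasurable
  refine (integral_map (hN z).aemeasurable hmeas).trans ?_
  refine integral_congr_ae (Eventually.of_forall fun y => congrArg f (funext fun j => ?_))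
  have h1 := (hbVCpos z.1 j).ne'
  have h2 := (hbSpos (T z.2 z.1) j).ne'
  simp only [H, p, q, N]
  field_simp
  ring
end

section
/- For i = 2,…,N let a_i : ℝ → ℝ and b_i : ℝ → (0,∞) be functions such that for every y ∈ ℝ, a_i(t) + b_i(t)·y → +∞ as t → ∞. Define H^1(t) := t and, recursively for i = 2,…,N, H^i(t, y_2,…,y_i) := a_i(H^{i−1}(t, y_2,…,y_{i−1})) + b_i(H^{i−1}(t, y_2,…,y_{i−1}))·y_i. Then for every i = 1,…,N, every compact set K ⊆ ℝ^{i−1} and every T ∈ ℝ, there exists T_i ∈ ℝ such that t > T_i implies H^i(t, y_2,…,y_i) > T for all (y_2,…,y_i) ∈ K. -/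
open Filter

/-- **Auxiliary lemma for Theorem 2 (tail noise).**
For `i = 2, …, N` let `a i : ℝ → ℝ`, `b i : ℝ → (0,∞)` be such that
`a i t + b i t * y → ∞` as `t → ∞` for every `y`.  Define `H 1 t y = t` and
recursively `H i t y = a i (H (i-1) t y) + b i (H (i-1) t y) * y i`.
Then for every `1 ≤ i ≤ N`, every compact (i.e. bounded) range of the variables
`y 2, …, y i` and every level `T`, there is `T_i` such that `t > T_i` implies
`H i t y > T` uniformly over such `y`. -/
theorem composed_normings_tendsto_atTop_uniformly
    (N : ℕ) (a b : ℕ → ℝ → ℝ)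
    (hbpos : ∀ i, 2 ≤ i → i ≤ N → ∀ u : ℝ, 0 < b i u)
    (hdiv : ∀ i, 2 ≤ i → i ≤ N → ∀ y : ℝ,
      Tendsto (fun t : ℝ => a i t + b i t * y) atTop atTop)
    (H : ℕ → ℝ → (ℕ → ℝ) → ℝ)
    (hH1 : ∀ (t : ℝ) (y : ℕ → ℝ), H 1 t y = t)
    (hHrec : ∀ i, 2 ≤ i → i ≤ N → ∀ (t : ℝ) (y : ℕ → ℝ),
      H i t y = a i (H (i - 1) t y) + b i (H (i - 1) t y) * y i) :
    ∀ i, 1 ≤ i → i ≤ N → ∀ M : ℝ, ∀ T : ℝ, ∃ Ti : ℝ, ∀ t > Ti, ∀ y : ℕ → ℝ,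
      (∀ j, 2 ≤ j → j ≤ i → |y j| ≤ M) → H i t y > T := by
  intro i hi
  induction i, hi using Nat.le_induction with
  | base =>
    intro _ M T
    exact ⟨T, fun t ht y _ => by rwa [hH1]⟩
  | succ n hn ih =>
    intro hnN M T
    have h2 : 2 ≤ n + 1 := by omega
    obtain ⟨u₀, hu₀⟩ := eventually_atTop.mp
      ((hdiv (n + 1) h2 hnN (-M)).eventually_gt_atTop T)
    obtain ⟨Ti, hTi⟩ := ih (by omega) M u₀
    refine ⟨Ti, fun t ht y hy => ?_⟩
    have hprev : u₀ < H n t y := hTi t ht y fun j hj hjn => hy j hj (by omega)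
    rw [hHrec (n + 1) h2 hnN, Nat.add_sub_cancel]
    have hyM : -M ≤ y (n + 1) := (abs_le.mp (hy (n + 1) h2 le_rfl)).1
    have hmul := mul_le_mul_of_nonneg_left hyM (hbpos (n + 1) h2 hnN (H n t y)).le
    linarith [hu₀ (H n t y) hprev.le]
end
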